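/- Let j₁, j₂, j₃, j₄, S, S' be half-integers (elements of ½·ℕ) such that a := j₁+j₂−S, b := j₁−j₂+S, c := j₂−j₁+S, p := j₃+j₄−S, q := j₃−j₄+S, r := j₄−j₃+S are all nonnegative integers, and likewise a', b', c', p', q', r' defined with S' in place of S are all nonnegative integers. Define P_S : (ℂ²)⁴ → ℂ by P_S(z₁,z₂,z₃,z₄) := Σ over all nonnegative integers k₁₃,k₁₄,k₂₃,k₂₄ with k₁₃+k₁₄ = b, k₂₃+k₂₄ = c, k₁₃+k₂₃ = q, k₁₄+k₂₄ = r of [z₁|z₂⟩^a [z₃|z₄⟩^p [z₁|z₃⟩^{k₁₃} [z₁|z₄⟩^{k₁₄} [z₂|z₃⟩^{k₂₃} [z₂|z₄⟩^{k₂₄} / (a!·p!·k₁₃!·k₁₄!·k₂₃!·k₂₄!), and define P_{S'} analogously. Then ∫_{(ℂ²)⁴} conj(P_S(z)) · P_{S'}(z) ∏_{i=1}^4 dμ(z_i) equals 0 if S ≠ S', and equals (j₁+j₂+S+1)! · (j₃+j₄+S+1)! / ( (2S+1) · a! · b! · c! · p! · q! · r! ) if S = S'. (This is the orthogonality and norm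 of the orthogonal 4-valent intertwiner basis: ⟨S|S'⟩ = δ_{S,S'} Δ²(j₁j₂S) Δ²(j₃j₄S)/(2S+1).) -/

import Mathlib

/-!
STATEMENT 6: orthogonality and norm of the orthogonal 4-valent intertwiner
basis: ⟨S|S'⟩ = δ_{S,S'} Δ²(j₁j₂S)·Δ²(j₃j₄S)/(2S+1).
-/

noncomputable section

open MeasureTheory

abbrev Spinor := Fin 2 → ℂ

/-- The holomorphic bracket `[z|w⟩ = z₀w₁ − z₁w₀`. -/
def bra (z w : Spinor) : ℂ := z 0 * w 1 - z 1 * w 0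

/-- Density of the Gaussian measure dμ(z) = π⁻²·e^(−⟨z|z⟩) dz on ℂ². -/
def gdens (z : Spinor) : ℝ :=
  Real.pi⁻¹ ^ 2 * Real.exp (-(Complex.normSq (z 0) + Complex.normSq (z 1)))

/-- The orthogonal-basis state `P_S`, as the sum over T of discrete-coherent
monomials, parameterized by the nonnegative integers
a = j₁+j₂−S, b = j₁−j₂+S, c = j₂−j₁+S, p = j₃+j₄−S, q = j₃−j₄+S, r = j₄−j₃+S. -/
def PS (a b c p q r : ℕ) (z : Fin 4 → Spinor) : ℂ :=
  ∑' t : {t : ℕ × ℕ × ℕ × ℕ //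
      t.1 + t.2.1 = b ∧ t.2.2.1 + t.2.2.2 = c ∧
      t.1 + t.2.2.1 = q ∧ t.2.1 + t.2.2.2 = r},
    bra (z 0) (z 1) ^ a * bra (z 2) (z 3) ^ p
      * bra (z 0) (z 2) ^ t.1.1 * bra (z 0) (z 3) ^ t.1.2.1
      * bra (z 1) (z 2) ^ t.1.2.2.1 * bra (z 1) (z 3) ^ t.1.2.2.2
      / ((Nat.factorial a : ℂ) * (Nat.factorial p : ℂ)
        * (Nat.factorial t.1.1 : ℂ) * (Nat.factorial t.1.2.1 : ℂ)
        * (Nat.factorial t.1.2.2.1 : ℂ) * (Nat.factorial t.1.2.2.2 : ℂ))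

/-- The one-variable Gaussian moment integrand `conj z ^ m * z ^ n * π⁻¹ * exp (-|z|²)`. -/
def gaussMoment (m n : ℕ) (z : ℂ) : ℂ :=
  starRingEnd ℂ z ^ m * z ^ n * ((Real.pi⁻¹ * Real.exp (-Complex.normSq z) : ℝ) : ℂ)

lemma integral_norm_pow_mul_gaussian (k : ℕ) :
    ∫ z : ℂ, ‖z‖ ^ k * (Real.pi⁻¹ * Real.exp (-Complex.normSq z)) =
      Real.Gamma ((k + 2) / 2) := by
  have h := Complex.integral_rpow_mul_exp_neg_rpow (p := 2) (q := k) (by norm_num)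
    (by have : (0 : ℝ) ≤ k := k.cast_nonneg
        linarith)
  have e : ∀ z : ℂ, ‖z‖ ^ k * (Real.pi⁻¹ * Real.exp (-Complex.normSq z)) =
      Real.pi⁻¹ * (‖z‖ ^ (k : ℝ) * Real.exp (-‖z‖ ^ (2 : ℝ))) := by
    intro z
    rw [Real.rpow_natCast, Real.rpow_two, Complex.normSq_eq_norm_sq]
    ring
  simp_rw [e]
  rw [integral_const_mul, h]
  have := Real.pi_ne_zero
  field_simp

lemma integrable_gaussMoment (m n : ℕ) : Integrable (gaussMoment m n) := by
  have h : Integrable fun z : ℂ =>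
      ‖z‖ ^ (m + n) * (Real.pi⁻¹ * Real.exp (-Complex.normSq z)) := by
    by_contra hn
    have h := integral_norm_pow_mul_gaussian (m + n)
    rw [integral_undef hn] at h
    exact (Real.Gamma_pos_of_pos (by positivity)).ne h
  refine h.mono' ?_ ?_
  · unfold gaussMoment
    have : Continuous fun z : ℂ => starRingEnd ℂ z ^ m * z ^ n *
        ((Real.pi⁻¹ * Real.exp (-Complex.normSq z) : ℝ) : ℂ) := by
      have := Complex.continuous_normSq
      have := Complex.continuous_conj
      fun_prop
    exact this.aestronglyMeasurable
  · refine .of_forall fun z => le_of_eq ?_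
    unfold gaussMoment
    rw [norm_mul, norm_mul, norm_pow, norm_pow, RCLike.norm_conj, Complex.norm_real,
      Real.norm_of_nonneg (by positivity), pow_add]

lemma integral_gaussMoment (m n : ℕ) :
    ∫ z, gaussMoment m n z = if m = n then (n.factorial : ℂ) else 0 := by
  split_ifs with h
  · subst h
    have e : ∀ z : ℂ, gaussMoment m m z =
        ((‖z‖ ^ (2 * m) * (Real.pi⁻¹ * Real.exp (-Complex.normSq z)) : ℝ) : ℂ) := by
      intro z
      unfold gaussMoment
      rw [← mul_pow, ← Complex.normSq_eq_conj_mul_self, Complex.normSq_eq_norm_sq]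
      push_cast
      ring
    simp_rw [e]
    rw [integral_complex_ofReal, integral_norm_pow_mul_gaussian]
    have : (((2 * m : ℕ) : ℝ) + 2) / 2 = m + 1 := by push_cast; ring
    rw [this, Real.Gamma_nat_eq_factorial]
    simp
  · obtain ⟨u, hu⟩ : ∃ u : Circle, starRingEnd ℂ (u : ℂ) ^ m * (u : ℂ) ^ n = -1 := by
      have hd : ((n : ℝ) - m) ≠ 0 := sub_ne_zero.2 (by exact_mod_cast Ne.symm h)
      refine ⟨Circle.exp (Real.pi / (n - m)), ?_⟩
      rw [← Circle.coe_inv_eq_conj, ← Circle.exp_neg, Circle.coe_exp, Circle.coe_exp,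
        ← Complex.exp_nat_mul, ← Complex.exp_nat_mul, ← Complex.exp_add,
        ← Complex.exp_pi_mul_I]
      congr 1
      have hd' : ((n : ℂ) - m) ≠ 0 := by exact_mod_cast hd
      push_cast
      field_simp
      ring
    have hr := (rotation u).measurePreserving.integral_comp
      (rotation u).toHomeomorph.measurableEmbedding (gaussMoment m n)
    have e : ∀ z, gaussMoment m n (rotation u z) = -gaussMoment m n z := by
      intro z
      have : gaussMoment m n (rotation u z) =
          (starRingEnd ℂ (u : ℂ) ^ m * (u : ℂ) ^ n) * gaussMoment m n z := by
        simp only [gaussMoment, rotation_apply, map_mul, mul_pow, Complex.normSq_eq_norm_sq,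
          Circle.norm_coe]
        ring_nf
      rw [this, hu, neg_one_mul]
    simp_rw [e] at hr
    rw [integral_neg] at hr
    exact self_eq_neg.1 hr.symm

/-- Real polynomials in the components of four spinors. -/
abbrev SpinorPoly := MvPolynomial (Fin 4 × Fin 2) ℝ

/-- Evaluation of a polynomial at a configuration of four spinors. -/
def evalSpinor (z : Fin 4 → Spinor) : SpinorPoly →ₐ[ℝ] ℂ :=
  MvPolynomial.aeval fun ij => z ij.1 ij.2

/-- The integrand of the Bargmann–Fock pairing of two polynomials. -/
def fockIntegrand (f g : SpinorPoly) (z : Fin 4 → Spinor) : ℂ :=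
  starRingEnd ℂ (evalSpinor z f) * evalSpinor z g * ∏ i, (gdens (z i) : ℂ)

/-- The Bargmann–Fock pairing of two polynomials. -/
def fock (f g : SpinorPoly) : ℂ := ∫ z, fockIntegrand f g z

open MvPolynomial

lemma fockIntegrand_add_left (f f' g : SpinorPoly) :
    fockIntegrand (f + f') g = fockIntegrand f g + fockIntegrand f' g := by
  funext z
  simp only [fockIntegrand, map_add, Pi.add_apply]
  ring

lemma fockIntegrand_add_right (f g g' : SpinorPoly) :
    fockIntegrand f (g + g') = fockIntegrand f g + fockIntegrand f g' := by
  funext z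
  simp only [fockIntegrand, map_add, Pi.add_apply]
  ring

lemma fockIntegrand_monomial (α β : Fin 4 × Fin 2 →₀ ℕ) (x y : ℝ) (z : Fin 4 → Spinor) :
    fockIntegrand (monomial α x) (monomial β y) z =
      (x * y : ℂ) * ∏ i, ∏ j, gaussMoment (α (i, j)) (β (i, j)) (z i j) := by
  have hg : ∀ w : Spinor, (gdens w : ℂ) =
      ∏ j, ((Real.pi⁻¹ * Real.exp (-Complex.normSq (w j)) : ℝ) : ℂ) := by
    intro w
    rw [Fin.prod_univ_two, ← Complex.ofReal_mul, gdens, neg_add, Real.exp_add]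
    congr 1
    ring
  simp only [fockIntegrand, evalSpinor, aeval_monomial, gaussMoment, hg, map_mul,
    Complex.coe_algebraMap, Complex.conj_ofReal, Finset.prod_mul_distrib]
  rw [Finsupp.prod_fintype _ _ (by simp), Finsupp.prod_fintype _ _ (by simp),
    Fintype.prod_prod_type, Fintype.prod_prod_type]
  simp only [map_prod, map_pow]
  ring

lemma integrable_fockIntegrand (f g : SpinorPoly) : Integrable (fockIntegrand f g) := by
  induction f using MvPolynomial.induction_on' with
  | add p q hp hq => rw [fockIntegrand_add_left]; exact hp.add hq
  | monomial α x =>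
    induction g using MvPolynomial.induction_on' with
    | add p q hp hq => rw [fockIntegrand_add_right]; exact hp.add hq
    | monomial β y =>
      rw [funext (fockIntegrand_monomial α β x y)]
      refine Integrable.const_mul ?_ _
      exact Integrable.fintype_prod (f := fun i (w : Spinor) =>
        ∏ j, gaussMoment (α (i, j)) (β (i, j)) (w j)) fun i =>
          Integrable.fintype_prod fun j => integrable_gaussMoment _ _

lemma fock_add_left (f f' g : SpinorPoly) : fock (f + f') g = fock f g + fock f' g := by
  simp only [fock, fockIntegrand_add_left]
  exact integral_add (integrable_fockIntegrand _ _) (integrable_fockIntegrand _ _)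

lemma fock_add_right (f g g' : SpinorPoly) : fock f (g + g') = fock f g + fock f g' := by
  simp only [fock, fockIntegrand_add_right]
  exact integral_add (integrable_fockIntegrand _ _) (integrable_fockIntegrand _ _)

lemma fock_C_mul_left (x : ℝ) (f g : SpinorPoly) : fock (C x * f) g = x * fock f g := by
  rw [fock, fock, ← integral_const_mul]
  congr 1 with z
  simp only [fockIntegrand, evalSpinor, map_mul, algHom_C, Complex.coe_algebraMap,
    Complex.conj_ofReal]
  ring

lemma fock_C_mul_right (x : ℝ) (f g : SpinorPoly) : fock f (C x * g) = x * fock f g := by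
  rw [fock, fock, ← integral_const_mul]
  congr 1 with z
  simp only [fockIntegrand, evalSpinor, map_mul, algHom_C, Complex.coe_algebraMap]
  ring

lemma fock_conj_symm (f g : SpinorPoly) : starRingEnd ℂ (fock f g) = fock g f := by
  rw [fock, fock, ← integral_conj]
  congr 1 with z
  simp only [fockIntegrand, map_mul, map_prod, Complex.conj_ofReal, Complex.conj_conj]
  ring

lemma fock_zero_right (f : SpinorPoly) : fock f 0 = 0 := by
  simpa using fock_C_mul_right 0 f 0

lemma fock_sub_left (f f' g : SpinorPoly) : fock (f - f') g = fock f g - fock f' g := by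
  have := fock_add_left (f - f') f' g
  rw [sub_add_cancel] at this
  rw [this, add_sub_cancel_right]

lemma fock_sub_right (f g g' : SpinorPoly) : fock f (g - g') = fock f g - fock f g' := by
  have := fock_add_right f (g - g') g'
  rw [sub_add_cancel] at this
  rw [this, add_sub_cancel_right]

lemma fock_monomial (α β : Fin 4 × Fin 2 →₀ ℕ) (x y : ℝ) :
    fock (monomial α x) (monomial β y) =
      (x * y : ℂ) * ∏ ij, if α ij = β ij then ((β ij).factorial : ℂ) else 0 := by
  rw [fock, funext (fockIntegrand_monomial α β x y), integral_const_mul,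
    integral_fintype_prod_volume_eq_prod (fun i (w : Spinor) =>
      ∏ j, gaussMoment (α (i, j)) (β (i, j)) (w j)), Fintype.prod_prod_type]
  simp_rw [integral_fintype_prod_volume_eq_prod, integral_gaussMoment]

lemma fock_one_one : fock 1 1 = 1 := by
  have := fock_monomial 0 0 1 1
  simpa using this

/-- Multiplication by a variable is adjoint to the partial derivative. -/
lemma fock_X_mul (s : Fin 4 × Fin 2) (f g : SpinorPoly) :
    fock (X s * f) g = fock f (pderiv s g) := by
  induction f using MvPolynomial.induction_on' with
  | add p q hp hq => rw [mul_add, fock_add_left, fock_add_left, hp, hq]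
  | monomial α x =>
    induction g using MvPolynomial.induction_on' with
    | add p q hp hq => rw [map_add, fock_add_right, fock_add_right, hp, hq]
    | monomial β y =>
      set γ : Fin 4 × Fin 2 →₀ ℕ := β - Finsupp.single s 1 with hγ
      set α' : Fin 4 × Fin 2 →₀ ℕ := Finsupp.single s 1 + α with hα'
      have h : ∀ ij ∈ ({s}ᶜ : Finset (Fin 4 × Fin 2)),
          (if α' ij = β ij then ((β ij).factorial : ℂ) else 0) =
          if α ij = γ ij then ((γ ij).factorial : ℂ) else 0 := by
        intro ij hij
        have : s ≠ ij := fun h => by simp [h] at hij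
        simp [hγ, hα', Finsupp.single_eq_of_ne' this]
      rw [X, monomial_mul, pderiv_monomial, fock_monomial, fock_monomial, ← hγ, ← hα',
        Fintype.prod_eq_mul_prod_compl s, Fintype.prod_eq_mul_prod_compl s (fun ij =>
          if α ij = γ ij then ((γ ij).factorial : ℂ) else 0), Finset.prod_congr rfl h]
      simp only [hγ, hα', Finsupp.add_apply, Finsupp.tsub_apply, Finsupp.single_eq_same]
      rcases hb : β s with _ | n
      · simp
      · simp only [add_tsub_cancel_right, add_comm 1, add_left_inj]
        split_ifs <;> push_cast [Nat.factorial_succ] <;> ring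

lemma fock_sum_left {ι : Type*} (s : Finset ι) (f : ι → SpinorPoly) (g : SpinorPoly) :
    fock (∑ i ∈ s, f i) g = ∑ i ∈ s, fock (f i) g :=
  map_sum (AddMonoidHom.mk' (fun f => fock f g) fun f f' => fock_add_left f f' g) f s

/-- The bracket `[zᵢ|zⱼ⟩` as a polynomial. -/
def braPoly (i j : Fin 4) : SpinorPoly := X (i, 0) * X (j, 1) - X (i, 1) * X (j, 0)

/-- The second-order differential operator adjoint to multiplication by `[zᵢ|zⱼ⟩`. -/
def braDiff (i j : Fin 4) : SpinorPoly →ₗ[ℝ] SpinorPoly :=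
  (pderiv (j, 1)).toLinearMap ∘ₗ (pderiv (i, 0)).toLinearMap -
    (pderiv (j, 0)).toLinearMap ∘ₗ (pderiv (i, 1)).toLinearMap

lemma braDiff_apply (i j : Fin 4) (f : SpinorPoly) : braDiff i j f =
    pderiv (j, 1) (pderiv (i, 0) f) - pderiv (j, 0) (pderiv (i, 1) f) := rfl

/-- The Euler derivation, counting the total degree in the `i`-th and `j`-th spinors. -/
def euler (i j : Fin 4) : Derivation ℝ SpinorPoly SpinorPoly :=
  (X (i, 0) : SpinorPoly) • pderiv (i, 0) + (X (i, 1) : SpinorPoly) • pderiv (i, 1) +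
    ((X (j, 0) : SpinorPoly) • pderiv (j, 0) + (X (j, 1) : SpinorPoly) • pderiv (j, 1))

lemma euler_apply (i j : Fin 4) (f : SpinorPoly) : euler i j f =
    X (i, 0) * pderiv (i, 0) f + X (i, 1) * pderiv (i, 1) f +
      (X (j, 0) * pderiv (j, 0) f + X (j, 1) * pderiv (j, 1) f) := rfl

lemma fock_braPoly_mul (i j : Fin 4) (f g : SpinorPoly) :
    fock (braPoly i j * f) g = fock f (braDiff i j g) := by
  rw [braPoly, sub_mul, fock_sub_left, mul_assoc, mul_assoc, fock_X_mul, fock_X_mul, fock_X_mul,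
    fock_X_mul, ← fock_sub_right, braDiff_apply]

lemma fock_natCast_mul_right (n : ℕ) (f g : SpinorPoly) :
    fock f ((n : SpinorPoly) * g) = n * fock f g := by
  rw [← map_natCast (C : ℝ →+* SpinorPoly), fock_C_mul_right]
  simp

lemma braDiff_braPoly_mul {i j : Fin 4} (hij : i ≠ j) (g : SpinorPoly) :
    braDiff i j (braPoly i j * g) =
      2 * g + braPoly i j * braDiff i j g + euler i j g := by
  simp only [braDiff_apply, euler_apply, braPoly, pderiv_mul, map_sub, map_add, pderiv_X,
    Pi.single_apply, Prod.mk.injEq, hij, hij.symm, zero_ne_one, one_ne_zero, and_false, false_and,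
    and_self, if_true, if_false, mul_zero, zero_mul, map_zero, one_mul, mul_one]
  ring

lemma euler_braPoly {i j : Fin 4} (hij : i ≠ j) : euler i j (braPoly i j) = 2 * braPoly i j := by
  simp only [euler_apply, braPoly, pderiv_mul, map_sub, pderiv_X,
    Pi.single_apply, Prod.mk.injEq, hij, hij.symm, zero_ne_one, one_ne_zero, and_false, false_and,
    and_self, if_true, if_false, mul_zero, zero_mul, one_mul, mul_one]
  ring

section Harmonic

variable {i j : Fin 4} (hij : i ≠ j) {g : SpinorPoly} {d : ℕ}
  (hg : braDiff i j g = 0) (hd : euler i j g = d * g)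

include hij hd

lemma euler_braPoly_pow_mul (a : ℕ) :
    euler i j (braPoly i j ^ a * g) = (2 * a + d) * (braPoly i j ^ a * g) := by
  rw [Derivation.leibniz, Derivation.leibniz_pow, euler_braPoly hij, hd]
  rcases a with _ | a
  · simp [mul_comm]
  · simp only [smul_eq_mul, nsmul_eq_mul, add_tsub_cancel_right]
    push_cast
    ring

include hg

lemma braDiff_braPoly_pow_mul (a : ℕ) :
    braDiff i j (braPoly i j ^ (a + 1) * g) =
      (((a + 1) * (a + d + 2) : ℕ) : SpinorPoly) * (braPoly i j ^ a * g) := by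
  induction a with
  | zero =>
    rw [zero_add, pow_one, braDiff_braPoly_mul hij, hg, hd]
    push_cast
    ring
  | succ a ih =>
    rw [pow_succ', mul_assoc, braDiff_braPoly_mul hij, ih, euler_braPoly_pow_mul hij hd]
    push_cast
    ring

lemma fock_braPoly_pow_of_lt (f : SpinorPoly) {a b : ℕ} (hab : b < a) :
    fock (braPoly i j ^ a * f) (braPoly i j ^ b * g) = 0 := by
  induction b generalizing a with
  | zero =>
    obtain ⟨a, rfl⟩ := Nat.exists_eq_add_of_lt hab
    rw [pow_succ', mul_assoc, fock_braPoly_mul, pow_zero, one_mul, hg, fock_zero_right]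
  | succ b ih =>
    obtain ⟨a, rfl⟩ : ∃ m, a = m + 1 := ⟨a - 1, by lia⟩
    rw [pow_succ' _ a, mul_assoc, fock_braPoly_mul, braDiff_braPoly_pow_mul hij hg hd,
      fock_natCast_mul_right, ih (by lia), mul_zero]

lemma fock_braPoly_pow (f : SpinorPoly) (a : ℕ) :
    ((d + 1).factorial : ℂ) * fock (braPoly i j ^ a * f) (braPoly i j ^ a * g) =
      a.factorial * (a + d + 1).factorial * fock f g := by
  induction a with
  | zero => simp
  | succ a ih =>
    rw [pow_succ' _ a, mul_assoc (braPoly i j), fock_braPoly_mul, ← pow_succ',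
      braDiff_braPoly_pow_mul hij hg hd, fock_natCast_mul_right, mul_left_comm, ih,
      Nat.factorial_succ a, show a + 1 + d + 1 = (a + d + 1) + 1 by ring,
      Nat.factorial_succ (a + d + 1)]
    push_cast
    ring

end Harmonic

/-- The divided power `u ^ k / k!`, extended by zero to negative exponents. -/
def divPow (u : SpinorPoly) : ℤ → SpinorPoly
  | .ofNat n => C (n.factorial : ℝ)⁻¹ * u ^ n
  | .negSucc _ => 0

lemma divPow_natCast (u : SpinorPoly) (n : ℕ) : divPow u n = C (n.factorial : ℝ)⁻¹ * u ^ n := rfl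

lemma divPow_of_neg (u : SpinorPoly) {k : ℤ} (hk : k < 0) : divPow u k = 0 := by
  obtain ⟨n, rfl⟩ := Int.eq_negSucc_of_lt_zero hk
  rfl

lemma natCast_succ_mul_C_inv_factorial (n : ℕ) :
    ((n : SpinorPoly) + 1) * C ((n + 1).factorial : ℝ)⁻¹ = C (n.factorial : ℝ)⁻¹ := by
  rw [← map_natCast (C : ℝ →+* SpinorPoly), ← map_one (C : ℝ →+* SpinorPoly), ← map_add, ← map_mul,
    Nat.factorial_succ]
  congr 1
  push_cast
  field_simp

lemma mul_divPow (u : SpinorPoly) (k : ℤ) :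
    u * divPow u k = ((k : SpinorPoly) + 1) * divPow u (k + 1) := by
  rcases lt_or_ge k 0 with hk | hk
  · rw [divPow_of_neg u hk]
    rcases (show k + 1 ≤ 0 from hk).lt_or_eq with h | h
    · rw [divPow_of_neg u h]; simp
    · have : ((k : SpinorPoly) + 1) = 0 := by exact_mod_cast congrArg (Int.cast : ℤ → SpinorPoly) h
      rw [this]; simp
  · lift k to ℕ using hk
    have h : ((k : ℤ) + 1) = ((k + 1 : ℕ) : ℤ) := by push_cast; rfl
    rw [h, divPow_natCast, divPow_natCast, ← natCast_succ_mul_C_inv_factorial k]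
    push_cast
    ring

lemma mul_divPow_sub_one (u : SpinorPoly) (k : ℤ) :
    u * divPow u (k - 1) = (k : SpinorPoly) * divPow u k := by
  rw [mul_divPow]
  simp

lemma derivation_divPow (δ : Derivation ℝ SpinorPoly SpinorPoly) (u : SpinorPoly) (k : ℤ) :
    δ (divPow u k) = divPow u (k - 1) * δ u := by
  rcases lt_trichotomy k 0 with hk | rfl | hk
  · rw [divPow_of_neg u hk, divPow_of_neg u (k := k - 1) (by lia)]; simp
  · rw [divPow_of_neg u (k := 0 - 1) (by simp), ← Nat.cast_zero, divPow_natCast]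
    simp
  · obtain ⟨n, rfl⟩ : ∃ n : ℕ, k = ((n + 1 : ℕ) : ℤ) := ⟨(k - 1).toNat, by lia⟩
    rw [show ((n + 1 : ℕ) : ℤ) - 1 = (n : ℤ) by push_cast; ring, divPow_natCast, divPow_natCast,
      ← natCast_succ_mul_C_inv_factorial n, ← MvPolynomial.smul_eq_C_mul, Derivation.map_smul,
      MvPolynomial.smul_eq_C_mul, Derivation.leibniz_pow]
    simp only [smul_eq_mul, nsmul_eq_mul, add_tsub_cancel_right]
    push_cast
    ring

lemma pderiv_braPoly_of_ne {i k l : Fin 4} (hik : i ≠ k) (hil : i ≠ l) (x : Fin 2) :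
    pderiv (i, x) (braPoly k l) = 0 := by
  simp [braPoly, pderiv_X, hik.symm, hil.symm]

section Commute

variable {i j k l : Fin 4} (hik : i ≠ k) (hil : i ≠ l) (hjk : j ≠ k) (hjl : j ≠ l)

include hik hil hjk hjl

lemma braDiff_braPoly_pow_mul_of_ne (p : ℕ) (f : SpinorPoly) :
    braDiff i j (braPoly k l ^ p * f) = braPoly k l ^ p * braDiff i j f := by
  simp only [braDiff_apply, pderiv_mul, pderiv_pow, pderiv_braPoly_of_ne hik hil,
    pderiv_braPoly_of_ne hjk hjl, mul_zero, zero_mul, zero_add]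
  ring

lemma euler_braPoly_pow_mul_of_ne (p : ℕ) (f : SpinorPoly) :
    euler i j (braPoly k l ^ p * f) = braPoly k l ^ p * euler i j f := by
  simp only [euler_apply, pderiv_mul, pderiv_pow, pderiv_braPoly_of_ne hik hil,
    pderiv_braPoly_of_ne hjk hjl, mul_zero, zero_mul, zero_add]
  ring

end Commute

/-- The product of divided powers of the four brackets linking the pairs `i, j` and `k, l`. -/
def linkMonomial (i j k l : Fin 4) (α β γ δ : ℤ) : SpinorPoly :=
  divPow (braPoly i k) α * divPow (braPoly i l) β * divPow (braPoly j k) γ *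
    divPow (braPoly j l) δ

lemma linkMonomial_swap_left (i j k l : Fin 4) (α β γ δ : ℤ) :
    linkMonomial i j k l α β γ δ = linkMonomial j i k l γ δ α β := by
  unfold linkMonomial
  ring

lemma linkMonomial_swap_right (i j k l : Fin 4) (α β γ δ : ℤ) :
    linkMonomial i j k l α β γ δ = linkMonomial i j l k β α δ γ := by
  unfold linkMonomial
  ring

section LinkMonomial

variable {i j k l : Fin 4} (hij : i ≠ j) (hik : i ≠ k) (hil : i ≠ l) (hjk : j ≠ k) (hjl : j ≠ l)
  (hkl : k ≠ l) (α β γ δ : ℤ)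

include hij hik hil hjk hjl hkl

omit hjl in
lemma braDiff_linkMonomial :
    braDiff i k (linkMonomial i j k l α β γ δ) =
      ((α : SpinorPoly) + β + γ + 1) * linkMonomial i j k l (α - 1) β γ δ +
        ((δ : SpinorPoly) + 1) * linkMonomial i j k l α (β - 1) (γ - 1) (δ + 1) := by
  have h1 := mul_divPow_sub_one (braPoly i k) (α - 1)
  have h2 := mul_divPow_sub_one (braPoly i l) β
  have h3 := mul_divPow_sub_one (braPoly j k) γ
  have h4 := mul_divPow (braPoly j l) δ
  set u := divPow (braPoly i k) with hu
  set v := divPow (braPoly i l) with hv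
  set w := divPow (braPoly j k) with hw
  set s := divPow (braPoly j l) with hs
  have du := fun x y => derivation_divPow (pderiv x) (braPoly i k) y
  have dv := fun x y => derivation_divPow (pderiv x) (braPoly i l) y
  have dw := fun x y => derivation_divPow (pderiv x) (braPoly j k) y
  have ds := fun x y => derivation_divPow (pderiv x) (braPoly j l) y
  rw [← hu] at du
  rw [← hv] at dv
  rw [← hw] at dw
  rw [← hs] at ds
  simp only [braDiff_apply, linkMonomial, ← hu, ← hv, ← hw, ← hs, pderiv_mul, map_add, du, dv, dw,
    ds]
  simp only [braPoly, pderiv_mul, map_sub, pderiv_X, Pi.single_apply, Prod.mk.injEq, hij.symm,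
    hik, hik.symm, hil.symm, hjk, hkl.symm, zero_ne_one, one_ne_zero, and_false, false_and,
    and_self, if_true, if_false, mul_zero, zero_mul, map_zero, one_mul, mul_one, add_zero,
    zero_add, sub_zero, zero_sub, map_neg, sub_self]
  simp only [braPoly] at h1 h2 h3 h4
  push_cast at h1
  linear_combination (v β * w γ * s δ) * h1 + (u (α - 1) * w γ * s δ) * h2 +
    (u (α - 1) * v β * s δ) * h3 + (u α * v (β - 1) * w (γ - 1)) * h4

omit hkl in
lemma braDiff_left_linkMonomial :
    braDiff i j (linkMonomial i j k l α β γ δ) = braPoly k l *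
      (linkMonomial i j k l (α - 1) β γ (δ - 1) - linkMonomial i j k l α (β - 1) (γ - 1) δ) := by
  simp only [braDiff_apply, linkMonomial, pderiv_mul, map_add, derivation_divPow]
  simp only [braPoly, pderiv_mul, map_sub, pderiv_X, Pi.single_apply, Prod.mk.injEq, hij,
    hij.symm, hik.symm, hil.symm, hjk.symm, hjl.symm, zero_ne_one, one_ne_zero, and_false,
    false_and, and_self, if_true, if_false, mul_zero, zero_mul, map_zero, one_mul, add_zero,
    zero_add, sub_zero, zero_sub, map_neg, sub_self]
  ring

omit hij in
lemma braDiff_right_linkMonomial :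
    braDiff k l (linkMonomial i j k l α β γ δ) = braPoly i j *
      (linkMonomial i j k l (α - 1) β γ (δ - 1) - linkMonomial i j k l α (β - 1) (γ - 1) δ) := by
  simp only [braDiff_apply, linkMonomial, pderiv_mul, map_add, derivation_divPow]
  simp only [braPoly, pderiv_mul, map_sub, pderiv_X, Pi.single_apply, Prod.mk.injEq, hik, hil,
    hjk, hjl, hkl, hkl.symm, zero_ne_one, one_ne_zero, and_false, false_and, and_self, if_true,
    if_false, mul_zero, zero_mul, map_zero, mul_one, add_zero, zero_add, sub_zero, zero_sub,
    map_neg, sub_self]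
  ring

lemma euler_left_linkMonomial :
    euler i j (linkMonomial i j k l α β γ δ) =
      ((α : SpinorPoly) + β + γ + δ) * linkMonomial i j k l α β γ δ := by
  have e : ∀ {m n : Fin 4}, (m = i ∨ m = j) → (n = k ∨ n = l) →
      euler i j (braPoly m n) = braPoly m n := by
    rintro m n (rfl | rfl) (rfl | rfl) <;>
    simp [euler_apply, braPoly, pderiv_X, hij, hij.symm, hik.symm, hil.symm, hjk.symm,
      hjl.symm] <;> ring
  simp only [linkMonomial, Derivation.leibniz, derivation_divPow, smul_eq_mul,
    e (.inl rfl) (.inl rfl), e (.inl rfl) (.inr rfl), e (.inr rfl) (.inl rfl),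
    e (.inr rfl) (.inr rfl), mul_comm _ (braPoly _ _), mul_divPow_sub_one]
  ring

lemma euler_right_linkMonomial :
    euler k l (linkMonomial i j k l α β γ δ) =
      ((α : SpinorPoly) + β + γ + δ) * linkMonomial i j k l α β γ δ := by
  have e : ∀ {m n : Fin 4}, (m = i ∨ m = j) → (n = k ∨ n = l) →
      euler k l (braPoly m n) = braPoly m n := by
    rintro m n (rfl | rfl) (rfl | rfl) <;>
    simp [euler_apply, braPoly, pderiv_X, hik, hil, hjk, hjl, hkl, hkl.symm] <;> ring
  simp only [linkMonomial, Derivation.leibniz, derivation_divPow, smul_eq_mul,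
    e (.inl rfl) (.inl rfl), e (.inl rfl) (.inr rfl), e (.inr rfl) (.inl rfl),
    e (.inr rfl) (.inr rfl), mul_comm _ (braPoly _ _), mul_divPow_sub_one]
  ring

end LinkMonomial

lemma linkMonomial_eq_zero (i j k l : Fin 4) {α β γ δ : ℤ}
    (h : α < 0 ∨ β < 0 ∨ γ < 0 ∨ δ < 0) : linkMonomial i j k l α β γ δ = 0 := by
  unfold linkMonomial
  rcases h with h | h | h | h <;> simp [divPow_of_neg _ h]

/-- The sum of all products of divided powers of the brackets `[z₀|z₂⟩`, `[z₀|z₃⟩`, `[z₁|z₂⟩`,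
`[z₁|z₃⟩` of degrees `b`, `c`, `q`, `b + c - q` in the four spinors. -/
def linkSum (b c q : ℤ) : SpinorPoly :=
  ∑ᶠ n : ℤ, linkMonomial 0 1 2 3 n (b - n) (q - n) (c - q + n)

lemma hasFiniteSupport_linkSum (b c q : ℤ) :
    (fun n : ℤ => linkMonomial 0 1 2 3 n (b - n) (q - n) (c - q + n)).HasFiniteSupport := by
  refine (Set.finite_Icc 0 b).subset fun n hn => ?_
  by_contra h
  rw [Set.mem_Icc] at h
  exact hn (linkMonomial_eq_zero _ _ _ _ (by lia))

lemma finsum_add_shift {A B : ℤ → SpinorPoly} (hA : A.HasFiniteSupport) (hB : B.HasFiniteSupport)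
    (m : ℤ) : ∑ᶠ n, (A n + B (n + m)) = ∑ᶠ n, (A n + B n) := by
  have hB' : (fun n => B (n + m)).HasFiniteSupport :=
    Set.Finite.preimage (f := (· + m)) (add_left_injective m).injOn hB
  rw [finsum_add_distrib hA hB', finsum_add_distrib hA hB]
  congr 1
  exact finsum_comp_equiv (Equiv.addRight m)

/-- A linear map sending each term of one `linkSum` to a combination of two terms of another,
with weights adding up to the constant `x`, sends the first sum to `x` times the second. -/
lemma map_linkSum (L : SpinorPoly →ₗ[ℝ] SpinorPoly) {b c q b' c' q' : ℤ}
    {x : SpinorPoly} (v w : ℤ → SpinorPoly) (m : ℤ)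
    (hL : ∀ n, L (linkMonomial 0 1 2 3 n (b - n) (q - n) (c - q + n)) =
      v n * linkMonomial 0 1 2 3 n (b' - n) (q' - n) (c' - q' + n) +
        w (n + m) * linkMonomial 0 1 2 3 (n + m) (b' - (n + m)) (q' - (n + m)) (c' - q' + (n + m)))
    (hx : ∀ n, v n + w n = x) :
    L (linkSum b c q) = x * linkSum b' c' q' := by
  have hs := hasFiniteSupport_linkSum b' c' q'
  rw [linkSum, map_finsum L (hasFiniteSupport_linkSum b c q)]
  simp_rw [hL]
  refine (finsum_add_shift (hs.mul_right v) (hs.mul_right w) m).trans ?_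
  simp_rw [linkSum, mul_finsum' _ _ hs, Pi.mul_apply, ← add_mul, hx]

lemma braDiff_zero_two_linkSum (b c q : ℤ) :
    braDiff 0 2 (linkSum b c q) = ((b + c + 1 : ℤ) : SpinorPoly) * linkSum (b - 1) c (q - 1) := by
  refine map_linkSum _ (fun n => (c - q + n + 1 : ℤ)) (fun n => (b + q - n : ℤ)) (-1)
    (fun n => ?_) (fun n => by push_cast; ring)
  rw [braDiff_linkMonomial (by decide) (by decide) (by decide) (by decide) (by decide)]
  push_cast
  ring_nf

lemma braDiff_zero_three_linkSum (b c q : ℤ) :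
    braDiff 0 3 (linkSum b c q) = ((b + c + 1 : ℤ) : SpinorPoly) * linkSum (b - 1) c q := by
  refine map_linkSum _ (fun n => (b + c - q + n + 1 : ℤ)) (fun n => (q - n : ℤ)) (-1)
    (fun n => ?_) (fun n => by push_cast; ring)
  rw [linkMonomial_swap_right, braDiff_linkMonomial (by decide) (by decide)
    (by decide) (by decide) (by decide), linkMonomial_swap_right 0 1 3 2,
    linkMonomial_swap_right 0 1 3 2]
  push_cast
  ring_nf

lemma braDiff_one_two_linkSum (b c q : ℤ) :
    braDiff 1 2 (linkSum b c q) = ((b + c + 1 : ℤ) : SpinorPoly) * linkSum b (c - 1) (q - 1) := by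
  refine map_linkSum _ (fun n => (c + n + 1 : ℤ)) (fun n => (b - n : ℤ)) (-1)
    (fun n => ?_) (fun n => by push_cast; ring)
  rw [linkMonomial_swap_left, braDiff_linkMonomial (by decide) (by decide)
    (by decide) (by decide) (by decide), linkMonomial_swap_left 1 0 2 3,
    linkMonomial_swap_left 1 0 2 3]
  push_cast
  ring_nf

lemma braDiff_one_three_linkSum (b c q : ℤ) :
    braDiff 1 3 (linkSum b c q) = ((b + c + 1 : ℤ) : SpinorPoly) * linkSum b (c - 1) q := by
  refine map_linkSum _ (fun n => (b + c - n + 1 : ℤ)) (fun n => (n : ℤ)) 1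
    (fun n => ?_) (fun n => by push_cast; ring)
  rw [linkMonomial_swap_left, linkMonomial_swap_right, braDiff_linkMonomial (by decide) (by decide)
    (by decide) (by decide) (by decide), linkMonomial_swap_right 1 0 3 2,
    linkMonomial_swap_right 1 0 3 2, linkMonomial_swap_left 1 0 2 3,
    linkMonomial_swap_left 1 0 2 3]
  push_cast
  ring_nf

lemma braDiff_zero_one_linkSum (b c q : ℤ) : braDiff 0 1 (linkSum b c q) = 0 := by
  rw [map_linkSum (b' := b - 1) (c' := c - 1) (q' := q - 1) (x := 0) _
    (fun _ => -braPoly 2 3) (fun _ => braPoly 2 3) (-1) (fun n => ?_) (fun n => by ring), zero_mul]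
  rw [braDiff_left_linkMonomial (by decide) (by decide) (by decide) (by decide) (by decide)]
  ring_nf

lemma braDiff_two_three_linkSum (b c q : ℤ) : braDiff 2 3 (linkSum b c q) = 0 := by
  rw [map_linkSum (b' := b - 1) (c' := c - 1) (q' := q - 1) (x := 0) _
    (fun _ => -braPoly 0 1) (fun _ => braPoly 0 1) (-1) (fun n => ?_) (fun n => by ring), zero_mul]
  rw [braDiff_right_linkMonomial (by decide) (by decide) (by decide) (by decide) (by decide)]
  ring_nf

lemma euler_zero_one_linkSum (b c q : ℤ) :
    euler 0 1 (linkSum b c q) = ((b + c : ℤ) : SpinorPoly) * linkSum b c q := by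
  refine map_linkSum (euler 0 1).toLinearMap (fun _ => (b + c : ℤ)) (fun _ => 0) 0 (fun n => ?_)
    (fun n => by ring)
  refine (euler_left_linkMonomial (by decide) (by decide) (by decide) (by decide) (by decide)
    (by decide) _ _ _ _).trans ?_
  push_cast
  ring

lemma euler_two_three_linkSum (b c q : ℤ) :
    euler 2 3 (linkSum b c q) = ((b + c : ℤ) : SpinorPoly) * linkSum b c q := by
  refine map_linkSum (euler 2 3).toLinearMap (fun _ => (b + c : ℤ)) (fun _ => 0) 0 (fun n => ?_)
    (fun n => by ring)
  refine (euler_right_linkMonomial (by decide) (by decide) (by decide) (by decide) (by decide)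
    (by decide) _ _ _ _).trans ?_
  push_cast
  ring

lemma linkSum_zero : linkSum 0 0 0 = 1 := by
  rw [linkSum, finsum_eq_single _ 0 fun n hn => linkMonomial_eq_zero _ _ _ _ (by lia)]
  have h : ∀ u, divPow u 0 = 1 := fun u => by
    rw [← Nat.cast_zero, divPow_natCast]
    simp
  simp [linkMonomial, h]

lemma fock_intCast_mul_right (n : ℤ) (f g : SpinorPoly) :
    fock f ((n : SpinorPoly) * g) = n * fock f g := by
  rw [← map_intCast (C : ℝ →+* SpinorPoly), fock_C_mul_right]
  simp

lemma fock_braPoly_pow_linkSum (α β γ δ : ℕ) {b c q : ℤ} (hb : α + β = b) (hc : γ + δ = c)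
    (hq : α + γ = q) :
    fock (braPoly 0 2 ^ α * (braPoly 0 3 ^ β * (braPoly 1 2 ^ γ * braPoly 1 3 ^ δ)))
      (linkSum b c q) = (α + β + γ + δ + 1).factorial := by
  induction α generalizing b c q with
  | zero =>
    induction β generalizing b c q with
    | zero =>
      induction γ generalizing b c q with
      | zero =>
        induction δ generalizing b c q with
        | zero =>
          obtain ⟨rfl, rfl, rfl⟩ : b = 0 ∧ c = 0 ∧ q = 0 := by lia
          simp [linkSum_zero, fock_one_one]
        | succ δ ih =>
          simp only [pow_zero, one_mul] at ih ⊢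
          rw [pow_succ', fock_braPoly_mul, braDiff_one_three_linkSum, fock_intCast_mul_right,
            ih (by lia) (by lia) (by lia), ← hb, ← hc, ← add_assoc (0 + 0 + 0) δ 1,
            Nat.factorial_succ (0 + 0 + 0 + δ + 1)]
          push_cast
          ring
      | succ γ ih =>
        simp only [pow_zero, one_mul] at ih ⊢
        rw [pow_succ', mul_assoc, fock_braPoly_mul, braDiff_one_two_linkSum,
          fock_intCast_mul_right, ih (by lia) (by lia) (by lia), ← hb, ← hc,
          show 0 + 0 + (γ + 1) + δ = 0 + 0 + γ + δ + 1 by ring,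
          Nat.factorial_succ (0 + 0 + γ + δ + 1)]
        push_cast
        ring
    | succ β ih =>
      simp only [pow_zero, one_mul] at ih ⊢
      rw [pow_succ', mul_assoc, fock_braPoly_mul, braDiff_zero_three_linkSum,
        fock_intCast_mul_right, ih (by lia) (by lia) (by lia), ← hb, ← hc,
        show 0 + (β + 1) + γ + δ = 0 + β + γ + δ + 1 by ring,
        Nat.factorial_succ (0 + β + γ + δ + 1)]
      push_cast
      ring
  | succ α ih =>
    rw [pow_succ', mul_assoc, fock_braPoly_mul, braDiff_zero_two_linkSum,
      fock_intCast_mul_right, ih (by lia) (by lia) (by lia), ← hb, ← hc,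
      show α + 1 + β + γ + δ = α + β + γ + δ + 1 by ring,
      Nat.factorial_succ (α + β + γ + δ + 1)]
    push_cast
    ring

/-- The quadruples `(k₁₃, k₁₄, k₂₃, k₂₄)` of natural numbers forming a `2 × 2` matrix with row sums
`b`, `c` and column sums `q`, `r`. -/
def linkExponents (b c q r : ℕ) : Finset (ℕ × ℕ × ℕ × ℕ) :=
  (Finset.range (b + 1) ×ˢ Finset.range (b + 1) ×ˢ Finset.range (c + 1) ×ˢ
    Finset.range (c + 1)).filter fun t =>
      t.1 + t.2.1 = b ∧ t.2.2.1 + t.2.2.2 = c ∧ t.1 + t.2.2.1 = q ∧ t.2.1 + t.2.2.2 = r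

lemma mem_linkExponents {b c q r : ℕ} {t : ℕ × ℕ × ℕ × ℕ} :
    t ∈ linkExponents b c q r ↔
      t.1 + t.2.1 = b ∧ t.2.2.1 + t.2.2.2 = c ∧ t.1 + t.2.2.1 = q ∧ t.2.1 + t.2.2.2 = r := by
  simp only [linkExponents, Finset.mem_filter, Finset.mem_product, Finset.mem_range]
  lia

lemma linkSum_eq_sum {b c q r : ℕ} (h : b + c = q + r) :
    linkSum b c q = ∑ t ∈ linkExponents b c q r,
      C ((t.1.factorial : ℝ)⁻¹ * (t.2.1.factorial : ℝ)⁻¹ * (t.2.2.1.factorial : ℝ)⁻¹ *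
        (t.2.2.2.factorial : ℝ)⁻¹) *
      (braPoly 0 2 ^ t.1 * (braPoly 0 3 ^ t.2.1 * (braPoly 1 2 ^ t.2.2.1 *
        braPoly 1 3 ^ t.2.2.2))) := by
  have hinj : Set.InjOn (fun t : ℕ × ℕ × ℕ × ℕ => (t.1 : ℤ)) (linkExponents b c q r) := by
    rintro ⟨s, t, u, v⟩ hs ⟨s', t', u', v'⟩ hs' hss
    simp only [Finset.mem_coe, mem_linkExponents, Prod.mk.injEq] at hs hs' hss ⊢
    lia
  rw [linkSum, finsum_eq_sum_of_support_subset
    (s := (linkExponents b c q r).image fun t => (t.1 : ℤ)), Finset.sum_image hinj]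
  · refine Finset.sum_congr rfl fun t ht => ?_
    obtain ⟨h1, h2, h3, h4⟩ := mem_linkExponents.1 ht
    rw [show (b : ℤ) - t.1 = (t.2.1 : ℕ) by lia, show (q : ℤ) - t.1 = (t.2.2.1 : ℕ) by lia,
      show (c : ℤ) - q + t.1 = (t.2.2.2 : ℕ) by lia]
    simp only [linkMonomial, divPow_natCast, map_mul]
    ring
  · intro n hn
    have hn' : 0 ≤ n ∧ n ≤ b ∧ n ≤ q ∧ 0 ≤ (c : ℤ) - q + n := by
      by_contra hcon
      exact hn (linkMonomial_eq_zero _ _ _ _ (by lia))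
    rw [Finset.mem_coe, Finset.mem_image]
    refine ⟨(n.toNat, b - n.toNat, q - n.toNat, c + n.toNat - q), mem_linkExponents.2 ?_, ?_⟩ <;>
    simp only <;> lia

lemma sum_linkExponents {b c q r : ℕ} (h : b + c = q + r) :
    ∑ t ∈ linkExponents b c q r, ((t.1.factorial : ℂ)⁻¹ * (t.2.1.factorial : ℂ)⁻¹ *
      (t.2.2.1.factorial : ℂ)⁻¹ * (t.2.2.2.factorial : ℂ)⁻¹) =
      (b + c).factorial / (b.factorial * c.factorial * q.factorial * r.factorial) := by
  have hne (n : ℕ) : (n.factorial : ℂ) ≠ 0 := Nat.cast_ne_zero.2 n.factorial_ne_zero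
  have key : ∑ t ∈ linkExponents b c q r, b.choose t.1 * c.choose t.2.2.1 = (b + c).choose q := by
    rw [Nat.add_choose_eq]
    refine Finset.sum_of_injOn (fun t => (t.1, t.2.2.1)) ?_ ?_ ?_ fun _ _ => rfl
    · rintro ⟨s, t, u, v⟩ hs ⟨s', t', u', v'⟩ hs' hss
      simp only [Finset.mem_coe, mem_linkExponents, Prod.mk.injEq] at hs hs' hss ⊢
      lia
    · rintro t ht
      simpa using (mem_linkExponents.1 ht).2.2.1
    · rintro ⟨s, t⟩ hs hst
      rw [Finset.HasAntidiagonal.mem_antidiagonal] at hs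
      by_contra hcon
      simp only [mul_eq_zero, Nat.choose_eq_zero_iff, not_or, not_lt] at hcon
      refine hst ⟨(s, b - s, t, c - t), Finset.mem_coe.2 (mem_linkExponents.2 ?_), rfl⟩
      simp only at hs ⊢
      lia
  have hq : ((b + c).choose q : ℂ) = (b + c).factorial / (q.factorial * r.factorial) := by
    rw [h, Nat.cast_add_choose]
  rw [show ((b + c).factorial / (b.factorial * c.factorial * q.factorial * r.factorial) : ℂ) =
    (b.factorial * c.factorial : ℂ)⁻¹ * ((b + c).factorial / (q.factorial * r.factorial)) by
      field_simp [hne], ← hq, ← key, Nat.cast_sum, Finset.mul_sum]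
  refine Finset.sum_congr rfl fun t ht => ?_
  obtain ⟨rfl, rfl, -, -⟩ := mem_linkExponents.1 ht
  rw [Nat.cast_mul, Nat.cast_add_choose, Nat.cast_add_choose]
  field_simp [hne]

lemma fock_linkSum {b c q r : ℕ} (h : b + c = q + r) :
    fock (linkSum b c q) (linkSum b c q) = (b + c + 1).factorial *
      ((b + c).factorial / (b.factorial * c.factorial * q.factorial * r.factorial)) := by
  nth_rw 1 [linkSum_eq_sum h]
  rw [fock_sum_left, ← sum_linkExponents h, Finset.mul_sum]
  refine Finset.sum_congr rfl fun t ht => ?_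
  obtain ⟨h1, h2, h3, h4⟩ := mem_linkExponents.1 ht
  rw [fock_C_mul_left, fock_braPoly_pow_linkSum _ _ _ _ (by lia) (by lia) (by lia),
    show t.1 + t.2.1 + t.2.2.1 + t.2.2.2 = b + c by lia]
  push_cast
  ring

/-- The polynomial whose values are those of the state `PS`. -/
def statePoly (a b c p q : ℕ) : SpinorPoly :=
  C ((a.factorial : ℝ)⁻¹ * (p.factorial : ℝ)⁻¹) *
    (braPoly 0 1 ^ a * (braPoly 2 3 ^ p * linkSum b c q))

lemma evalSpinor_braPoly (z : Fin 4 → Spinor) (i j : Fin 4) :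
    evalSpinor z (braPoly i j) = bra (z i) (z j) := by
  simp [evalSpinor, braPoly, bra]

lemma evalSpinor_C (z : Fin 4 → Spinor) (x : ℝ) : evalSpinor z (C x) = x := by
  simp [evalSpinor]

lemma PS_eq_evalSpinor {a b c p q r : ℕ} (h : b + c = q + r) (z : Fin 4 → Spinor) :
    PS a b c p q r z = evalSpinor z (statePoly a b c p q) := by
  let _ := Fintype.subtype (linkExponents b c q r) fun t => mem_linkExponents
  rw [PS, tsum_fintype, ← Finset.sum_subtype (linkExponents b c q r) (fun t => mem_linkExponents)
    (fun t : ℕ × ℕ × ℕ × ℕ => bra (z 0) (z 1) ^ a * bra (z 2) (z 3) ^ p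
      * bra (z 0) (z 2) ^ t.1 * bra (z 0) (z 3) ^ t.2.1
      * bra (z 1) (z 2) ^ t.2.2.1 * bra (z 1) (z 3) ^ t.2.2.2
      / ((Nat.factorial a : ℂ) * (Nat.factorial p : ℂ)
        * (Nat.factorial t.1 : ℂ) * (Nat.factorial t.2.1 : ℂ)
        * (Nat.factorial t.2.2.1 : ℂ) * (Nat.factorial t.2.2.2 : ℂ)))]
  simp only [statePoly, linkSum_eq_sum h, map_mul, map_sum, map_pow, evalSpinor_braPoly,
    evalSpinor_C, Finset.mul_sum]
  refine Finset.sum_congr rfl fun t _ => ?_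
  push_cast
  rw [div_eq_mul_inv]
  simp only [mul_inv]
  ring

lemma fock_statePoly_of_lt {a b c p q a' b' c' p' q' : ℕ} (h : a' < a) :
    fock (statePoly a b c p q) (statePoly a' b' c' p' q') = 0 := by
  rw [statePoly, statePoly, fock_C_mul_left, fock_C_mul_right,
    fock_braPoly_pow_of_lt (d := b' + c') (by decide) _ _ _ h, mul_zero, mul_zero]
  · rw [braDiff_braPoly_pow_mul_of_ne (by decide) (by decide) (by decide) (by decide),
      braDiff_zero_one_linkSum, mul_zero]
  · rw [euler_braPoly_pow_mul_of_ne (by decide) (by decide) (by decide) (by decide),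
      euler_zero_one_linkSum]
    push_cast
    ring

lemma fock_statePoly_of_ne {a b c p q a' b' c' p' q' : ℕ} (h : a ≠ a') :
    fock (statePoly a b c p q) (statePoly a' b' c' p' q') = 0 := by
  rcases h.lt_or_gt with h | h
  · rw [← fock_conj_symm, fock_statePoly_of_lt h, map_zero]
  · exact fock_statePoly_of_lt h

lemma fock_statePoly_self {a b c p q r : ℕ} (h : b + c = q + r) :
    fock (statePoly a b c p q) (statePoly a b c p q) =
      ((a + b + c + 1).factorial : ℂ) * (p + q + r + 1).factorial /
        (((b : ℂ) + c + 1) * a.factorial * b.factorial * c.factorial * p.factorial * q.factorial *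
          r.factorial) := by
  have hne (n : ℕ) : (n.factorial : ℂ) ≠ 0 := Nat.cast_ne_zero.2 n.factorial_ne_zero
  have h1 := fock_braPoly_pow (i := 0) (j := 1) (d := b + c)
    (g := braPoly 2 3 ^ p * linkSum b c q) (by decide)
    (by rw [braDiff_braPoly_pow_mul_of_ne (by decide) (by decide) (by decide) (by decide),
      braDiff_zero_one_linkSum, mul_zero])
    (by
      rw [euler_braPoly_pow_mul_of_ne (by decide) (by decide) (by decide) (by decide),
        euler_zero_one_linkSum]
      push_cast
      ring) (braPoly 2 3 ^ p * linkSum b c q) a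
  have h2 := fock_braPoly_pow (i := 2) (j := 3) (d := b + c) (g := linkSum b c q) (by decide)
    (braDiff_two_three_linkSum b c q) (by rw [euler_two_three_linkSum]; push_cast; rfl)
    (linkSum b c q) p
  rw [fock_linkSum h] at h2
  rw [statePoly, fock_C_mul_left, fock_C_mul_right]
  rw [mul_comm, ← eq_div_iff (hne _)] at h1 h2
  rw [h1, h2, show p + q + r + 1 = p + (b + c) + 1 by lia,
    show a + b + c + 1 = a + (b + c) + 1 by ring, Nat.factorial_succ (b + c)]
  have hbc : (b : ℂ) + c + 1 ≠ 0 := by exact_mod_cast (b + c).succ_ne_zero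
  push_cast
  field_simp [hne]

theorem orthogonal_basis_scalar_product
    (j1 j2 j3 j4 S S' : ℚ)
    (hj1 : ∃ m : ℕ, j1 = m / 2) (hj2 : ∃ m : ℕ, j2 = m / 2)
    (hj3 : ∃ m : ℕ, j3 = m / 2) (hj4 : ∃ m : ℕ, j4 = m / 2)
    (hS : ∃ m : ℕ, S = m / 2) (hS' : ∃ m : ℕ, S' = m / 2)
    (a b c p q r a' b' c' p' q' r' : ℕ)
    (ha : (a : ℚ) = j1 + j2 - S) (hb : (b : ℚ) = j1 - j2 + S)
    (hc : (c : ℚ) = j2 - j1 + S) (hp : (p : ℚ) = j3 + j4 - S)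
    (hq : (q : ℚ) = j3 - j4 + S) (hr : (r : ℚ) = j4 - j3 + S)
    (ha' : (a' : ℚ) = j1 + j2 - S') (hb' : (b' : ℚ) = j1 - j2 + S')
    (hc' : (c' : ℚ) = j2 - j1 + S') (hp' : (p' : ℚ) = j3 + j4 - S')
    (hq' : (q' : ℚ) = j3 - j4 + S') (hr' : (r' : ℚ) = j4 - j3 + S') :
    (∫ z : Fin 4 → Spinor,
        starRingEnd ℂ (PS a b c p q r z) * PS a' b' c' p' q' r' z
          * ∏ i, (gdens (z i) : ℂ))
      = if S = S' then
          (Nat.factorial (a + b + c + 1) : ℂ) * (Nat.factorial (p + q + r + 1) : ℂ)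
            / (((b : ℂ) + (c : ℂ) + 1) * (Nat.factorial a : ℂ) * (Nat.factorial b : ℂ)
              * (Nat.factorial c : ℂ) * (Nat.factorial p : ℂ) * (Nat.factorial q : ℂ)
              * (Nat.factorial r : ℂ))
        else 0 := by
  have hbc : b + c = q + r := by
    have : (b : ℚ) + c = q + r := by linarith
    exact_mod_cast this
  have hbc' : b' + c' = q' + r' := by
    have : (b' : ℚ) + c' = q' + r' := by linarith
    exact_mod_cast this
  simp_rw [PS_eq_evalSpinor hbc, PS_eq_evalSpinor hbc']
  change fock (statePoly a b c p q) (statePoly a' b' c' p' q') = _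
  split_ifs with hSS
  · subst hSS
    obtain rfl : a = a' := by exact_mod_cast ha.trans ha'.symm
    obtain rfl : b = b' := by exact_mod_cast hb.trans hb'.symm
    obtain rfl : c = c' := by exact_mod_cast hc.trans hc'.symm
    obtain rfl : p = p' := by exact_mod_cast hp.trans hp'.symm
    obtain rfl : q = q' := by exact_mod_cast hq.trans hq'.symm
    exact fock_statePoly_self hbc
  · refine fock_statePoly_of_ne fun haa => hSS ?_
    subst haa
    linarith
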